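/- Let C be a hyperoctahedral category of partitions that is not group-theoretical. Then C = ⟨π_l, l ≤ k⟩ for some k ∈ ℕ, or C = ⟨π_l, l ∈ ℕ⟩. -/

import Mathlib

/-!
Basic combinatorics of categories of partitions (Banica–Speicher easy quantum groups).

A partition with `k` upper and `l` lower points is encoded as an equivalence
relation (a `Setoid`) on the set `Fin k ⊕ Fin l` of its points; its blocks are
the equivalence classes.
-/

namespace EasyQG

/-- A partition of `k` upper and `l` lower points into blocks. -/
abbrev Partition (k l : ℕ) : Type := Setoid (Fin k ⊕ Fin l)

/-- The relation "lying in the same block" of a partition. -/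
def inSameBlock {k l : ℕ} (p : Partition k l) :
    (Fin k ⊕ Fin l) → (Fin k ⊕ Fin l) → Prop :=
  @Setoid.r _ p

/-- The partition in `P(0,n)` associated to a word: two points lie in the same
block iff they carry the same letter. -/
def ofWord {n : ℕ} (w : Fin n → ℕ) : Partition 0 n :=
  Setoid.ker (Sum.elim Fin.elim0 w)

/-- The partition in `P(0,n)` associated to a word given as a list of letters. -/
def ofList (w : List ℕ) : Partition 0 w.length :=
  ofWord w.get

/-- The identity partition `|` in `P(1,1)`: one upper point joined to one lower point. -/
def idPartition : Partition 1 1 := ⊤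

/-- The pair partition `⊓` in `P(0,2)`: two points in one block. -/
def pairPartition : Partition 0 2 := ⊤

/-- The double singleton `↓⊗↓` in `P(0,2)`: two points in two different blocks. -/
def doubleSingleton : Partition 0 2 := ⊥

/-- The four block partition `⊓⊓` in `P(0,4)`: four points in one block (word `aaaa`). -/
def fourBlock : Partition 0 4 := ⊤

/-- The fat crossing partition in `P(4,4)`, with blocks `{1,2,3',4'}` and `{3,4,1',2'}`. -/
def fatCross : Partition 4 4 :=
  Setoid.ker (Sum.elim (fun i => decide (i.val < 2)) (fun j => decide (2 ≤ j.val)))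

/-- The pair positioner partition in `P(3,3)`, with blocks `{1,2,2',3'}` and `{3,1'}`. -/
def pairPositioner : Partition 3 3 :=
  Setoid.ker (Sum.elim (fun i => decide (i.val < 2)) (fun j => decide (1 ≤ j.val)))

/-- The `s`-mixing partition `h_s ∈ P(0,2s)`, the word `abab…ab` of length `2s`. -/
def sMixing (s : ℕ) : Partition 0 (2 * s) := ofWord (fun i => i.val % 2)

/-- The partition `π_k ∈ P(0,4k)`, the word `a₁…a_k a_k…a₁ a₁…a_k a_k…a₁`
in `k` distinct letters. -/
def piPartition (k : ℕ) : Partition 0 (4 * k) :=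
  ofWord (fun i =>
    if i.val % (2 * k) < k then i.val % (2 * k) else 2 * k - 1 - i.val % (2 * k))

/-- The disjoint sum of two set partitions. -/
def sumSetoid {α β : Type*} (ra : Setoid α) (rb : Setoid β) : Setoid (α ⊕ β) where
  r := Sum.LiftRel (@Setoid.r _ ra) (@Setoid.r _ rb)
  iseqv := by
    constructor
    · intro x
      cases x with
      | inl a => exact Sum.LiftRel.inl (ra.iseqv.refl a)
      | inr b => exact Sum.LiftRel.inr (rb.iseqv.refl b)
    · intro x y h
      cases h with
      | inl h => exact Sum.LiftRel.inl (ra.iseqv.symm h)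
      | inr h => exact Sum.LiftRel.inr (rb.iseqv.symm h)
    · intro x y z h1 h2
      cases h1 with
      | inl h1 => cases h2 with
        | inl h2 => exact Sum.LiftRel.inl (ra.iseqv.trans h1 h2)
      | inr h1 => cases h2 with
        | inr h2 => exact Sum.LiftRel.inr (rb.iseqv.trans h1 h2)

/-- Tensor product (horizontal concatenation) of partitions. -/
def tensor {k l k' l' : ℕ} (p : Partition k l) (q : Partition k' l') :
    Partition (k + k') (l + l') :=
  Setoid.comap
    (fun x => (Equiv.sumSumSumComm (Fin k) (Fin k') (Fin l) (Fin l'))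
      (Sum.map finSumFinEquiv.symm finSumFinEquiv.symm x))
    (sumSetoid p q)

/-- Composition (vertical concatenation) of partitions `p ∈ P(k,l)` and `q ∈ P(l,m)`:
blocks are joined along the `l` middle points, which are then deleted. -/
def comp {k l m : ℕ} (p : Partition k l) (q : Partition l m) : Partition k m :=
  Setoid.comap (Sum.map id Sum.inr)
    (Relation.EqvGen.setoid (fun x y : Fin k ⊕ (Fin l ⊕ Fin m) =>
      (∃ a b, inSameBlock p a b ∧ Sum.map id Sum.inl a = x ∧ Sum.map id Sum.inl b = y) ∨
      (∃ a b, inSameBlock q a b ∧ Sum.inr a = x ∧ Sum.inr b = y)))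

/-- Involution (turning a partition upside down). -/
def involution {k l : ℕ} (p : Partition k l) : Partition l k :=
  Setoid.comap Sum.swap p

/-- Rotation moving the leftmost upper point to the left end of the lower row. -/
def rotUL {k l : ℕ} (p : Partition (k + 1) l) : Partition k (l + 1) :=
  Setoid.comap
    (Sum.elim (fun i => Sum.inl i.succ)
      (fun j => Fin.cases (Sum.inl (0 : Fin (k + 1))) (fun j' => Sum.inr j') j)) p

/-- Rotation moving the leftmost lower point to the left end of the upper row. -/
def rotLU {k l : ℕ} (p : Partition k (l + 1)) : Partition (k + 1) l :=
  Setoid.comap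
    (Sum.elim (fun i => Fin.cases (Sum.inr (0 : Fin (l + 1))) (fun i' => Sum.inl i') i)
      (fun j => Sum.inr j.succ)) p

/-- Rotation moving the rightmost upper point to the right end of the lower row. -/
def rotUR {k l : ℕ} (p : Partition (k + 1) l) : Partition k (l + 1) :=
  Setoid.comap
    (Sum.elim (fun i => Sum.inl i.castSucc)
      (fun j => Fin.lastCases (Sum.inl (Fin.last k)) (fun j' => Sum.inr j') j)) p

/-- Rotation moving the rightmost lower point to the right end of the upper row. -/
def rotRU {k l : ℕ} (p : Partition k (l + 1)) : Partition (k + 1) l :=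
  Setoid.comap
    (Sum.elim (fun i => Fin.lastCases (Sum.inr (Fin.last l)) (fun i' => Sum.inl i') i)
      (fun j => Sum.inr j.castSucc)) p

/-- A category of partitions: a collection of partitions containing the identity
partition and closed under the category operations (tensor product, composition,
involution and the four rotations). -/
structure PartitionCategory where
  mem : Set (Σ k l : ℕ, Partition k l)
  id_mem : ⟨1, 1, idPartition⟩ ∈ mem
  tensor_mem : ∀ {k l k' l' : ℕ} {p : Partition k l} {q : Partition k' l'},
    ⟨k, l, p⟩ ∈ mem → ⟨k', l', q⟩ ∈ mem → ⟨k + k', l + l', tensor p q⟩ ∈ mem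
  comp_mem : ∀ {k l m : ℕ} {p : Partition k l} {q : Partition l m},
    ⟨k, l, p⟩ ∈ mem → ⟨l, m, q⟩ ∈ mem → ⟨k, m, comp p q⟩ ∈ mem
  involution_mem : ∀ {k l : ℕ} {p : Partition k l},
    ⟨k, l, p⟩ ∈ mem → ⟨l, k, involution p⟩ ∈ mem
  rotUL_mem : ∀ {k l : ℕ} {p : Partition (k + 1) l},
    ⟨k + 1, l, p⟩ ∈ mem → ⟨k, l + 1, rotUL p⟩ ∈ mem
  rotLU_mem : ∀ {k l : ℕ} {p : Partition k (l + 1)},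
    ⟨k, l + 1, p⟩ ∈ mem → ⟨k + 1, l, rotLU p⟩ ∈ mem
  rotUR_mem : ∀ {k l : ℕ} {p : Partition (k + 1) l},
    ⟨k + 1, l, p⟩ ∈ mem → ⟨k, l + 1, rotUR p⟩ ∈ mem
  rotRU_mem : ∀ {k l : ℕ} {p : Partition k (l + 1)},
    ⟨k, l + 1, p⟩ ∈ mem → ⟨k + 1, l, rotRU p⟩ ∈ mem

/-- The members of the smallest category of partitions containing `S`
(the category `⟨S⟩` generated by `S`). -/
def generated (S : Set (Σ k l : ℕ, Partition k l)) : Set (Σ k l : ℕ, Partition k l) :=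
  {x | ∀ C : PartitionCategory, S ⊆ C.mem → x ∈ C.mem}

/-- A category of partitions is hyperoctahedral if it contains the four block
partition `⊓⊓` but not the double singleton `↓⊗↓`. -/
def Hyperoctahedral (C : PartitionCategory) : Prop :=
  (⟨0, 4, fourBlock⟩ : Σ k l : ℕ, Partition k l) ∈ C.mem ∧
    (⟨0, 2, doubleSingleton⟩ : Σ k l : ℕ, Partition k l) ∉ C.mem

/-- A category of partitions is group-theoretical if it contains the pair
positioner partition. -/
def GroupTheoretical (C : PartitionCategory) : Prop :=
  (⟨3, 3, pairPositioner⟩ : Σ k l : ℕ, Partition k l) ∈ C.mem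

/-- The generating set `{π_l | 1 ≤ l ≤ k}`. -/
def piUpTo (k : ℕ) : Set (Σ k l : ℕ, Partition k l) :=
  {x | ∃ l : ℕ, 1 ≤ l ∧ l ≤ k ∧ x = ⟨0, 4 * l, piPartition l⟩}

/-- The generating set `{π_l | l ∈ ℕ, l ≥ 1}`. -/
def piAll : Set (Σ k l : ℕ, Partition k l) :=
  {x | ∃ l : ℕ, 1 ≤ l ∧ x = ⟨0, 4 * l, piPartition l⟩}

end EasyQG
namespace EasyQG

/-- Merging the blocks of the points `x` and `y` of a partition. -/
def merge {k l : ℕ} (p : Partition k l) (x y : Fin k ⊕ Fin l) : Partition k l :=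
  Relation.EqvGen.setoid (fun u v => inSameBlock p u v ∨ (u = x ∧ v = y) ∨ (u = y ∧ v = x))

/-- The word `a_{i(1)}^{k(1)} … a_{i(m)}^{k(m)}` determined by a list of
letters with exponents. -/
def expand (blocks : List (ℕ × ℕ)) : List ℕ :=
  (blocks.map fun be => List.replicate be.2 be.1).flatten

/-- The run decomposition of a word: the list of its (letter, exponent) blocks. -/
def runs : List ℕ → List (ℕ × ℕ)
  | [] => []
  | a :: rest =>
    match runs rest with
    | [] => [(a, 1)]
    | (b, e) :: rs => if a = b then (b, e + 1) :: rs else (a, 1) :: (b, e) :: rs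

/-- The single-double leg form associated to a word: every odd exponent is
replaced by `1` and every even exponent by `2`. -/
def sdForm (w : List ℕ) : List ℕ :=
  expand ((runs w).map fun be => (be.1, if Odd be.2 then 1 else 2))

/-- A word is in single-double leg form if all its exponents are `1` or `2`. -/
def IsSingleDoubleLegForm (w : List ℕ) : Prop :=
  ∃ blocks : List (ℕ × ℕ), List.Chain' (fun x y => x.1 ≠ y.1) blocks ∧
    (∀ b ∈ blocks, b.2 = 1 ∨ b.2 = 2) ∧ w = expand blocks

/-- The vertical reflection of a partition: the left-to-right order of the
points is reversed in both rows, keeping the block structure. -/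
def verticalReflect {k l : ℕ} (p : Partition k l) : Partition k l :=
  Setoid.comap (Sum.map Fin.rev Fin.rev) p

/-- `leg [a₁,…,a_k] [X₁,…,X_{k-1}] = a₁ X₁ a₂ X₂ … a_{k-1} X_{k-1} a_k`:
a list of letters interleaved with filler words. -/
def leg : List ℕ → List (List ℕ) → List ℕ
  | [], _ => []
  | [a], _ => [a]
  | a :: rest, Xs => a :: (Xs.headD [] ++ leg rest Xs.tail)

/-- A word contains a W of depth `k` if it can be written as
`Y₁ S_α X_k^α S_β Y₂ S_γ X_k^γ S_δ Y₃`, where `S_α = a₁X₁^α a₂X₂^α…a_k`,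
`S_β = a_k X_{k-1}^β…X₁^β a₁`, `S_γ = a₁X₁^γ…a_k`, `S_δ = a_k X_{k-1}^δ…X₁^δ a₁`
for `k` distinct letters `a₁,…,a_k`, each of which occurs an odd number of
times in each of `S_α`, `S_β`, `S_γ`, `S_δ`. -/
def ContainsW (w : List ℕ) (k : ℕ) : Prop :=
  ∃ (as : List ℕ) (Xa Xb Xc Xd : List (List ℕ)) (Xka Xkc Y1 Y2 Y3 : List ℕ),
    as.length = k ∧ as.Nodup ∧
    Xa.length = k - 1 ∧ Xb.length = k - 1 ∧ Xc.length = k - 1 ∧ Xd.length = k - 1 ∧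
    w = Y1 ++ leg as Xa ++ Xka ++ leg as.reverse Xb ++ Y2 ++
        leg as Xc ++ Xkc ++ leg as.reverse Xd ++ Y3 ∧
    ∀ a ∈ as, Odd ((leg as Xa).count a) ∧ Odd ((leg as.reverse Xb).count a) ∧
      Odd ((leg as Xc).count a) ∧ Odd ((leg as.reverse Xd).count a)

/-- `wdepth w` is the maximal `k` such that some rotated version of the
word `w` contains a W of depth `k`. -/
noncomputable def wdepth (w : List ℕ) : ℕ :=
  sSup {k | ∃ r : ℕ, ContainsW (w.rotate r) k}

end EasyQG

namespace EasyQG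

/-- Membership of the partition given by labelling upper points by `u` and lower points by `v`. -/
def VMem (C : PartitionCategory) (u v : List ℕ) : Prop :=
  (⟨u.length, v.length, Setoid.ker (Sum.elim u.get v.get)⟩ : Σ k l : ℕ, Partition k l) ∈ C.mem

lemma mem_VMem (C : PartitionCategory) {k l : ℕ} (p : Partition k l) (u v : List ℕ)
    (hu : u.length = k) (hv : v.length = l)
    (hp : ∀ x y, p x y ↔ Sum.elim (fun i : Fin k => u.get (i.cast hu.symm))
      (fun i : Fin l => v.get (i.cast hv.symm)) x =
      Sum.elim (fun i : Fin k => u.get (i.cast hu.symm))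
      (fun i : Fin l => v.get (i.cast hv.symm)) y) :
    (⟨k, l, p⟩ : Σ k l : ℕ, Partition k l) ∈ C.mem ↔ VMem C u v := by
  subst hu hv
  unfold VMem
  have : p = Setoid.ker (Sum.elim u.get v.get) := by
    ext x y
    exact hp x y
  rw [this]

lemma VMem_UL (C : PartitionCategory) (a : ℕ) (u v : List ℕ) (h : VMem C (a :: u) v) :
    VMem C u (a :: v) := by
  have h1 := C.rotUL_mem (p := Setoid.ker (Sum.elim (a :: u).get v.get)) h
  refine (mem_VMem C _ u (a :: v) rfl rfl ?_).1 h1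
  have key : ∀ x : Fin u.length ⊕ Fin (v.length + 1),
      Sum.elim (a :: u).get v.get (Sum.elim (fun i => Sum.inl i.succ)
      (fun j => Fin.cases (Sum.inl (0 : Fin (u.length + 1))) (fun j' => Sum.inr j') j) x) =
      Sum.elim u.get (a :: v).get x := by
    rintro (i | j)
    · rfl
    · refine Fin.cases ?_ (fun j => ?_) j <;> rfl
  intro x y
  have := key x
  have := key y
  change Sum.elim (a :: u).get v.get _ = Sum.elim (a :: u).get v.get _ ↔
    Sum.elim u.get (a :: v).get x = Sum.elim u.get (a :: v).get y
  rw [key x, key y]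

lemma VMem_LU (C : PartitionCategory) (a : ℕ) (u v : List ℕ) (h : VMem C u (a :: v)) :
    VMem C (a :: u) v := by
  have h1 := C.rotLU_mem (p := Setoid.ker (Sum.elim u.get (a :: v).get)) h
  refine (mem_VMem C _ (a :: u) v rfl rfl ?_).1 h1
  have key : ∀ x : Fin (u.length + 1) ⊕ Fin (v.length),
      Sum.elim u.get (a :: v).get (Sum.elim
      (fun j => Fin.cases (Sum.inr (0 : Fin (v.length + 1))) (fun j' => Sum.inl j') j)
      (fun i => Sum.inr i.succ) x) =
      Sum.elim (a :: u).get v.get x := by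
    rintro (j | i)
    · refine Fin.cases ?_ (fun j => ?_) j <;> rfl
    · rfl
  intro x y
  change Sum.elim u.get (a :: v).get _ = Sum.elim u.get (a :: v).get _ ↔
    Sum.elim (a :: u).get v.get x = Sum.elim (a :: u).get v.get y
  rw [key x, key y]

lemma VMem_iff (C : PartitionCategory) (u v : List ℕ) :
    VMem C u v ↔ VMem C [] (u.reverse ++ v) := by
  induction u generalizing v with
  | nil => simp
  | cons a u ih =>
    rw [show (a :: u).reverse ++ v = u.reverse ++ (a :: v) by simp, ← ih]
    exact ⟨VMem_UL C a u v, VMem_LU C a u v⟩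

lemma VMem_rot (C : PartitionCategory) (a : ℕ) (w : List ℕ) (h : VMem C [] (a :: w)) :
    VMem C [] (w ++ [a]) := by
  have h0 := VMem_LU C a [] w h
  have h1 := C.rotUR_mem (k := 0) (p := Setoid.ker (Sum.elim [a].get w.get)) h0
  refine (mem_VMem C _ [] (w ++ [a]) rfl (by simp) ?_).1 h1
  have key : ∀ x : Fin 0 ⊕ Fin (w.length + 1),
      Sum.elim [a].get w.get (Sum.elim (fun i : Fin 0 => Sum.inl i.castSucc)
      (fun j => Fin.lastCases (Sum.inl (Fin.last 0)) (fun j' => Sum.inr j') j) x) =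
      Sum.elim (fun i : Fin 0 => 0) (fun j : Fin (w.length + 1) =>
        (w ++ [a]).get (j.cast (by simp))) x := by
    rintro (i | j)
    · exact i.elim0
    · refine Fin.lastCases ?_ (fun j => ?_) j
      · simp
      · simp
  rintro (x | x) (y | y)
  · exact x.elim0
  · exact x.elim0
  · exact y.elim0
  change Sum.elim [a].get w.get _ = Sum.elim [a].get w.get _ ↔ _
  erw [key (.inr x), key (.inr y)]
  rfl

lemma VMem_rev (C : PartitionCategory) (w : List ℕ) (h : VMem C [] w) :
    VMem C [] w.reverse := by
  have h1 := C.involution_mem (p := Setoid.ker (Sum.elim [].get w.get)) h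
  have h2 : VMem C w [] := by
    refine (mem_VMem C _ w [] rfl rfl ?_).1 h1
    rintro (x | x) (y | y)
    · rfl
    · exact y.elim0
    · exact x.elim0
    · exact x.elim0
  simpa using (VMem_iff C w []).1 h2

lemma VMem_relabel (C : PartitionCategory) (w : List ℕ) (f : ℕ → ℕ)
    (hf : ∀ x ∈ w, ∀ y ∈ w, f x = f y → x = y) (h : VMem C [] w) :
    VMem C [] (w.map f) := by
  refine (mem_VMem C _ [] (w.map f) rfl (by simp) ?_).1 h
  rintro (x | x) (y | y)
  · exact x.elim0
  · exact x.elim0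
  · exact y.elim0
  change w.get x = w.get y ↔ (w.map f).get _ = (w.map f).get _
  simp only [List.get_eq_getElem, List.getElem_map, Fin.val_cast]
  exact ⟨fun h => by rw [h], fun h => hf _ (List.getElem_mem _) _ (List.getElem_mem _) h⟩

lemma VMem_app (C : PartitionCategory) (w v : List ℕ)
    (hf : ∀ x ∈ w, x ∉ v) (hw : VMem C [] w) (hv : VMem C [] v) :
    VMem C [] (w ++ v) := by
  have h1 := C.tensor_mem hw hv
  refine (mem_VMem C _ [] (w ++ v) rfl (by simp) ?_).1 h1
  rintro (x | x) (y | y)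
  · exact x.elim0
  · exact x.elim0
  · exact y.elim0
  have hne : ∀ (i : Fin w.length) (j : Fin v.length), w.get i ≠ v.get j := by
    intro i j h
    exact hf _ (List.get_mem w i) (h ▸ List.get_mem v j)
  refine Fin.addCases (fun x => ?_) (fun x => ?_) x <;>
  refine Fin.addCases (fun y => ?_) (fun y => ?_) y
  all_goals
    change Sum.LiftRel _ _ _ _ ↔ _
    have hne1 := hne
    simp at hne1 ⊢
  · exact hne1 _ _
  · exact fun h => hne1 _ _ h.symm

lemma VMem_pair (C : PartitionCategory) : VMem C [] [0, 0] := by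
  have h : VMem C [0] [0] := by
    refine (mem_VMem C _ [0] [0] rfl rfl ?_).1 C.id_mem
    intro x y
    have : ∀ z : Fin 1 ⊕ Fin 1, Sum.elim (fun i : Fin 1 => [0].get i) (fun i : Fin 1 => [0].get i) z = 0 := by
      rintro (z | z) <;> simp
    exact ⟨fun _ => (this x).trans (this y).symm, fun _ => trivial⟩
  simpa using (VMem_iff C [0] [0]).1 h

lemma VMem_comm (C : PartitionCategory) (u v : List ℕ) (h : VMem C [] (u ++ v)) :
    VMem C [] (v ++ u) := by
  induction u generalizing v with
  | nil => simpa using h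
  | cons a u ih =>
    have := ih (v ++ [a]) (by simpa using VMem_rot C a (u ++ v) h)
    simpa using this

lemma VMem_nest (C : PartitionCategory) (r : List ℕ) (h0 : ∀ x ∈ r, x ≠ 0) (hr : r.Nodup) :
    VMem C [] (r.reverse ++ [0, 0] ++ r) := by
  induction r using List.reverseRecOn with
  | nil => simpa using VMem_pair C
  | append_singleton r x ih =>
    have h1 := ih (fun y hy => h0 y (by simp [hy])) (List.Nodup.of_append_left hr)
    have hx : x ∉ r := by
      have := List.nodup_append.1 hr
      intro hh
      exact this.2.2 x hh x (by simp) rfl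
    have h2 := VMem_relabel C [0, 0] (fun _ => x) (by simp) (VMem_pair C)
    have hx0 := h0 x (by simp)
    have h3 := VMem_app C _ _ (by
      intro y hy
      simp at hy ⊢
      rintro rfl
      rcases hy with hy | hy | hy <;> first | exact hx hy | exact hx0 hy) h1 h2
    have h4 := VMem_comm C (r.reverse ++ [0, 0] ++ r ++ [x]) [x] (by simpa using h3)
    simpa using h4

lemma VMem_contr (C : PartitionCategory) (a b : ℕ) (v : List ℕ) (h : VMem C [] (a :: b :: v)) :
    VMem C [] (v.map (fun x => if x = b then a else x)) := by
  set r := (List.range v.length).map Nat.succ with hr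
  have hrl : r.length = v.length := by simp [hr]
  have hn := VMem_nest C r (by simp [hr]) (by
    rw [hr]; exact List.Nodup.map Nat.succ_injective List.nodup_range)
  have hq : VMem C (0 :: 0 :: r) r := by
    rw [VMem_iff]
    simpa using hn
  let q : Partition (v.length + 2) v.length :=
    Setoid.ker (Sum.elim (fun i => i.val - 1) (fun j => j.val + 1))
  have hq' : (⟨v.length + 2, v.length, q⟩ : Σ k l : ℕ, Partition k l) ∈ C.mem := by
    refine (mem_VMem C q (0 :: 0 :: r) r (by simp [hrl]) hrl ?_).2 hq
    have key : ∀ x : Fin (v.length + 2) ⊕ Fin v.length,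
      Sum.elim (fun i : Fin (v.length + 2) => i.val - 1) (fun j => j.val + 1) x =
      Sum.elim (fun i : Fin (v.length + 2) => (0 :: 0 :: r).get (i.cast (by simp [hrl])))
        (fun i : Fin v.length => r.get (i.cast hrl.symm)) x := by
      rintro (i | i)
      · refine Fin.cases ?_ (fun i => ?_) i
        · simp
        · refine Fin.cases ?_ (fun i => ?_) i
          · simp
          · simp [hr]
      · simp [hr]
    intro x y
    change Sum.elim (fun i : Fin (v.length + 2) => i.val - 1) (fun j => j.val + 1) x =
      Sum.elim (fun i : Fin (v.length + 2) => i.val - 1) (fun j => j.val + 1) y ↔ _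
    rw [key, key]
  have h1 := C.comp_mem (p := Setoid.ker (Sum.elim ([] : List ℕ).get (a :: b :: v).get)) h hq'
  refine (mem_VMem C _ [] (v.map _) rfl (by simp) ?_).1 h1
  rintro (x | x) (y | y)
  · exact x.elim0
  · exact x.elim0
  · exact y.elim0
  set σ : ℕ → ℕ := (fun x => if x = b then a else x) with hσ
  have hR : Sum.elim (fun i : Fin 0 => ([] : List ℕ).get i)
      (fun i : Fin v.length => (v.map σ).get (i.cast (by simp))) (Sum.inr x) =
      Sum.elim (fun i : Fin 0 => ([] : List ℕ).get i)
      (fun i : Fin v.length => (v.map σ).get (i.cast (by simp))) (Sum.inr y) ↔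
      σ (v.get x) = σ (v.get y) := by simp
  refine Iff.trans ?_ hR.symm
  change Relation.EqvGen _ (Sum.inr (Sum.inr x)) (Sum.inr (Sum.inr y)) ↔ _
  set Rl := (fun x y : Fin 0 ⊕ (Fin (v.length + 2) ⊕ Fin v.length) =>
      (∃ c d, inSameBlock (Setoid.ker (Sum.elim ([] : List ℕ).get (a :: b :: v).get)) c d ∧
        Sum.map id Sum.inl c = x ∧ Sum.map id Sum.inl d = y) ∨
      (∃ c d, inSameBlock q c d ∧ Sum.inr c = x ∧ Sum.inr d = y)) with hRl
  change Relation.EqvGen Rl _ _ ↔ _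
  constructor
  · intro hxy
    let F : Fin 0 ⊕ (Fin (v.length + 2) ⊕ Fin v.length) → ℕ :=
      Sum.elim (fun _ => 0) (Sum.elim (fun i => σ ((a :: b :: v).get i)) (fun j => σ (v.get j)))
    have hF : ∀ x y, Rl x y → F x = F y := by
      rintro x y (⟨c, d, hcd, rfl, rfl⟩ | ⟨c, d, hcd, rfl, rfl⟩)
      · rcases c with c | c
        · exact c.elim0
        rcases d with d | d
        · exact d.elim0
        change (a :: b :: v).get c = (a :: b :: v).get d at hcd
        change σ _ = σ _
        rw [hcd]
      · let G : ℕ → ℕ := fun n => if hn : n = 0 then σ a else if h : n - 1 < v.length then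
          σ (v.get ⟨n - 1, h⟩) else 0
        have hG : ∀ c : Fin (v.length + 2) ⊕ Fin v.length,
            F (Sum.inr c) = G (Sum.elim (fun i => i.val - 1) (fun j => j.val + 1) c) := by
          rintro (i | i)
          · refine Fin.cases ?_ (fun i => ?_) i
            · simp [F, G]
            · refine Fin.cases ?_ (fun i => ?_) i
              · simp [F, G, hσ]
              · simp [F, G]
          · simp [F, G]
        change Sum.elim (fun i : Fin (v.length + 2) => i.val - 1) (fun j => j.val + 1) c =
          Sum.elim (fun i : Fin (v.length + 2) => i.val - 1) (fun j => j.val + 1) d at hcd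
        rw [hG, hG, hcd]
    have : ∀ x y, Relation.EqvGen Rl x y → F x = F y := by
      intro x y h
      induction h with
      | rel x y h => exact hF x y h
      | refl x => rfl
      | symm x y _ ih => exact ih.symm
      | trans x y z _ _ ih1 ih2 => exact ih1.trans ih2
    exact this _ _ hxy
  · intro hxy
    have s1 : ∀ x : Fin v.length, Relation.EqvGen Rl (Sum.inr (Sum.inr x))
        (Sum.inr (Sum.inl x.succ.succ)) := by
      intro x
      refine Relation.EqvGen.rel _ _ (Or.inr ⟨Sum.inr x, Sum.inl x.succ.succ, ?_, rfl, rfl⟩)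
      change x.val + 1 = x.succ.succ.val - 1
      simp
    have s2 : Relation.EqvGen Rl (Sum.inr (Sum.inl 0)) (Sum.inr (Sum.inl 1)) := by
      refine Relation.EqvGen.rel _ _ (Or.inr ⟨Sum.inl 0, Sum.inl 1, ?_, rfl, rfl⟩)
      change (0 : Fin (v.length + 2)).val - 1 = (1 : Fin (v.length + 2)).val - 1
      simp
    have s3 : ∀ i j : Fin (v.length + 2), (a :: b :: v).get i = (a :: b :: v).get j →
        Relation.EqvGen Rl (Sum.inr (Sum.inl i)) (Sum.inr (Sum.inl j)) := by
      intro i j hij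
      exact Relation.EqvGen.rel _ _ (Or.inl ⟨Sum.inr i, Sum.inr j, hij, rfl, rfl⟩)
    have s4 : ∀ x : Fin v.length, v.get x = b → Relation.EqvGen Rl (Sum.inr (Sum.inl 0))
        (Sum.inr (Sum.inl x.succ.succ)) := by
      intro x hx
      exact s2.trans _ _ _ (s3 1 x.succ.succ (by simpa using hx.symm))
    have s5 : ∀ x : Fin v.length, v.get x = a → Relation.EqvGen Rl (Sum.inr (Sum.inl 0))
        (Sum.inr (Sum.inl x.succ.succ)) := by
      intro x hx
      exact (s3 0 x.succ.succ (by simpa using hx.symm))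
    have s6 : Relation.EqvGen Rl (Sum.inr (Sum.inl x.succ.succ))
        (Sum.inr (Sum.inl y.succ.succ)) := by
      simp only [hσ] at hxy
      split_ifs at hxy with e1 e2 e2
      · exact ((s4 x e1).symm).trans _ _ _ (s4 y e2)
      · exact ((s4 x e1).symm).trans _ _ _ (s5 y hxy.symm)
      · exact ((s5 x hxy).symm).trans _ _ _ (s4 y e2)
      · exact s3 _ _ (by simpa using hxy)
    exact ((s1 x).trans _ _ _ s6).trans _ _ _ (s1 y).symm

lemma exists_lists {k l : ℕ} (p : Partition k l) : ∃ u v : List ℕ, ∀ C : PartitionCategory,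
    (⟨k, l, p⟩ : Σ k l : ℕ, Partition k l) ∈ C.mem ↔ VMem C u v := by
  obtain ⟨f, hf⟩ := exists_injective_nat (Quotient p)
  refine ⟨List.ofFn (fun i => f (Quotient.mk p (Sum.inl i))), List.ofFn (fun i => f (Quotient.mk p (Sum.inr i))), fun C => ?_⟩
  refine mem_VMem C p _ _ (by simp) (by simp) ?_
  have key : ∀ x : Fin k ⊕ Fin l, Sum.elim (fun i : Fin k =>
      (List.ofFn (fun i => f (Quotient.mk p (Sum.inl i)))).get (i.cast (by simp)))
      (fun i : Fin l => (List.ofFn (fun i => f (Quotient.mk p (Sum.inr i)))).get (i.cast (by simp))) x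
      = f (Quotient.mk p x) := by
    rintro (i | i) <;> simp
  intro x y
  rw [key, key, hf.eq_iff]
  exact Quotient.eq.symm

end EasyQG

namespace EasyQG

/-- A set of words closed under the category operations. -/
structure WC (M : List ℕ → Prop) : Prop where
  pair : M [0, 0]
  relabel : ∀ (w : List ℕ) (f : ℕ → ℕ), (∀ x ∈ w, ∀ y ∈ w, f x = f y → x = y) → M w → M (w.map f)
  comm : ∀ u v : List ℕ, M (u ++ v) → M (v ++ u)
  rev : ∀ w : List ℕ, M w → M w.reverse
  app : ∀ w v : List ℕ, (∀ x ∈ w, x ∉ v) → M w → M v → M (w ++ v)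
  contr0 : ∀ (a b : ℕ) (v : List ℕ), M (a :: b :: v) → M (v.map (fun x => if x = b then a else x))

namespace WC
variable {M : List ℕ → Prop}

lemma nil (h : WC M) : M [] := by
  simpa using h.contr0 0 0 [] h.pair

/-- Contraction of two neighbouring points. -/
lemma contr (h : WC M) (a b : ℕ) (u v : List ℕ) (hw : M (u ++ a :: b :: v)) :
    M ((u ++ v).map (fun x => if x = b then a else x)) := by
  have h1 := h.contr0 a b (v ++ u) (by simpa using h.comm _ _ hw)
  rw [List.map_append] at h1 ⊢
  exact h.comm _ _ h1

lemma del (h : WC M) (a : ℕ) (u v : List ℕ) (hw : M (u ++ a :: a :: v)) : M (u ++ v) := by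
  have := h.contr a a u v hw
  rwa [show (fun x => if x = a then a else x) = id by funext x; by_cases hx : x = a <;> simp [hx],
    List.map_id] at this

lemma ins (h : WC M) (u x v : List ℕ) (hd : ∀ y ∈ x, y ∉ u ∧ y ∉ v) (hw : M (u ++ v)) (hx : M x) :
    M (u ++ x ++ v) := by
  have h1 := h.app (v ++ u) x (by
    intro y hy hy'
    have := hd y hy'
    simp at hy
    tauto) (h.comm _ _ hw) hx
  have := h.comm v (u ++ x) (by simpa using h1)
  exact this

/-- Contraction of a word against its primed mirror image. -/
lemma contrMany (h : WC M) (f : ℕ → ℕ) (hf : ∀ x, f (f x) = f x) (A : List ℕ) :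
    ∀ (U V : List ℕ), (∀ x ∈ U ++ V, f x = x ∨ x ∈ A) →
    M (U ++ (A.map f).reverse ++ A ++ V) → M ((U ++ V).map f) := by
  induction hn : A.length generalizing A with
  | zero =>
    intro U V hx hw
    have hA : A = [] := List.length_eq_zero_iff.1 hn
    subst hA
    have : (U ++ V).map f = U ++ V := by
      conv_rhs => rw [← List.map_id (U ++ V)]
      exact List.map_congr_left (fun x hxx => by simpa using hx x hxx)
    rw [this]
    simpa using hw
  | succ n ih =>
    intro U V hx hw
    obtain ⟨a, A, rfl⟩ : ∃ a B, A = a :: B := by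
      cases A with
      | nil => simp at hn
      | cons a B => exact ⟨a, B, rfl⟩
    have h1 := h.contr (f a) a (U ++ (A.map f).reverse) (A ++ V) (by simpa using hw)
    set σ : ℕ → ℕ := fun x => if x = a then f a else x with hσ
    have hfσ : ∀ x, f (σ x) = f x := by
      intro x
      by_cases hxa : x = a <;> simp [hσ, hxa, hf]
    have hσf : ∀ x, σ (f x) = f x := by
      intro x
      by_cases hxa : f x = a
      · simp only [hσ, hxa, if_true]
        rw [← hxa, hf]
      · simp [hσ, hxa]
    have h2 := ih (A.map σ) (by simpa using hn) (U.map σ) (V.map σ) (by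
      intro x hxx
      rw [← List.map_append] at hxx
      obtain ⟨y, hy, rfl⟩ := List.mem_map.1 hxx
      by_cases hya : y = a
      · left; simp [hσ, hya, hf]
      · rcases hx y hy with h3 | h3
        · left; rw [hfσ]; simp [hσ, hya, h3]
        · right
          simp [hya] at h3
          exact List.mem_map_of_mem h3) (by
      have e : ((A.map σ).map f).reverse = ((A.map f).reverse).map σ := by
        rw [List.map_reverse, List.map_map, List.map_map]
        congr 1
        apply List.map_congr_left
        intro x _
        simp [hfσ, hσf]
      rw [e]
      simpa using h1)
    rw [← List.map_append, List.map_map] at h2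
    rwa [show f ∘ σ = f from funext hfσ] at h2

lemma relabelNodup (h : WC M) {n : ℕ} (w : List ℕ) (T' : List ℕ) (hn : T'.length = n)
    (hT' : T'.Nodup) (hwn : ∀ x ∈ w, x < n) (hw : M w) :
    M (w.map (fun x => T'.getD x 0)) := by
  refine h.relabel _ _ ?_ hw
  intro x hx y hy hxy
  have hx := hwn x hx
  have hy := hwn y hy
  rw [List.getD_eq_getElem _ _ (by omega), List.getD_eq_getElem _ _ (by omega)] at hxy
  exact (List.Nodup.getElem_inj_iff hT').1 hxy

end WC

/-- The word `π` on a given list of letters, innermost letter first. -/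
def piW (T : List ℕ) : List ℕ := T.reverse ++ T ++ T.reverse ++ T

/-- Stack reduction of a word. -/
def run : List ℕ → List ℕ → List ℕ
  | S, [] => S
  | [], y :: Y => run [y] Y
  | s :: S, y :: Y => if s = y then run S Y else run (y :: s :: S) Y

/-- A letter pushed on (or popped from) the stack. -/
def push (y : ℕ) : List ℕ → List ℕ
  | [] => [y]
  | s :: S => if s = y then S else y :: s :: S

lemma run_cons (S : List ℕ) (y : ℕ) (Y : List ℕ) : run S (y :: Y) = run (push y S) Y := by
  cases S with
  | nil => simp [run, push]
  | cons s S => by_cases hs : s = y <;> simp [run, push, hs]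

@[simp] lemma run_nil (S : List ℕ) : run S [] = S := by cases S <;> simp [run]

lemma run_append (S X Y : List ℕ) : run S (X ++ Y) = run (run S X) Y := by
  induction X generalizing S with
  | nil => simp
  | cons x X ih => simp [run_cons, ih]

abbrev Red (S : List ℕ) : Prop := S.IsChain (· ≠ ·)

lemma push_red (y : ℕ) (S : List ℕ) (hS : Red S) : Red (push y S) := by
  cases S with
  | nil => simp [push]
  | cons s S =>
    by_cases hs : s = y
    · simp only [push, hs, if_true]; exact hS.tail
    · simp only [push, hs, if_false]
      exact List.isChain_cons_cons.2 ⟨fun h => hs h.symm, hS⟩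

lemma push_push (y : ℕ) (S : List ℕ) (hS : Red S) : push y (push y S) = S := by
  cases S with
  | nil => simp [push]
  | cons s S =>
    by_cases hs : s = y
    · subst hs
      simp only [push, if_true]
      cases S with
      | nil => simp
      | cons t S =>
        have : s ≠ t := (List.isChain_cons_cons.1 hS).1
        simp [Ne.symm this]
    · simp [push, hs]

lemma run_red (S Y : List ℕ) (hS : Red S) : Red (run S Y) := by
  induction Y generalizing S with
  | nil => simpa
  | cons y Y ih => rw [run_cons]; exact ih _ (push_red y S hS)

lemma run_reverse (S Y : List ℕ) (hS : Red S) : run (run S Y) Y.reverse = S := by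
  induction Y generalizing S with
  | nil => simp
  | cons y Y ih =>
    rw [run_cons, List.reverse_cons, run_append, ih _ (push_red y S hS), run_cons, run_nil,
      push_push y S hS]

lemma run_of_red (U : List ℕ) : ∀ S : List ℕ, Red (S.reverse ++ U) → run S U = U.reverse ++ S := by
  induction U with
  | nil => simp
  | cons u U ih =>
    intro S hS
    have hp : push u S = u :: S := by
      cases S with
      | nil => rfl
      | cons s S =>
        have : s ≠ u := by
          have h2 : Red ((S.reverse) ++ s :: u :: U) := by simpa using hS
          exact (List.isChain_cons_cons.1 (List.IsChain.right_of_append h2)).1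
        simp [push, this]
    rw [run_cons, hp, ih (u :: S) (by simpa using hS)]
    simp

lemma run_nil_of_red (U : List ℕ) (h : Red U) : run [] U = U.reverse := by
  simpa using run_of_red U [] (by simpa using h)

/-- A word acts on stacks through its reduced form. -/
lemma run_normal (S X : List ℕ) (hS : Red S) : run S (run [] X).reverse = run S X := by
  induction X using List.reverseRecOn with
  | nil => simp
  | append_singleton X x ih =>
    rw [run_append, run_append _ X, ← ih, run_cons, run_cons, run_nil, run_nil]
    generalize hU : run [] X = U
    cases U with
    | nil => simp [push, run_cons]
    | cons u U =>
      by_cases hu : u = x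
      · subst hu
        rw [show push u (u :: U) = U by simp [push], List.reverse_cons, run_append, run_cons,
          run_nil, push_push]
        exact run_red _ _ hS
      · rw [show push x (u :: U) = x :: u :: U by simp [push, hu], List.reverse_cons, run_append,
          run_cons, run_nil]

lemma red_reverse (U : List ℕ) (h : Red U) : Red U.reverse := by
  rw [Red, List.isChain_reverse]
  exact h.imp (fun a b hab => Ne.symm hab)

lemma run_inverse (T X : List ℕ) (hT : Red T) (h : run T X = []) : run [] X = T.reverse := by
  have h1 : run [] X.reverse = T := by
    rw [← h, run_reverse T X hT]
  have hU : Red (run [] X) := run_red _ _ (by simp)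
  have h2 : run T (run [] X).reverse = [] := by rw [run_normal T X hT, h]
  have h3 : run [] (run [] X) = T := by
    have := run_reverse T (run [] X).reverse hT
    rwa [h2, List.reverse_reverse] at this
  rw [run_nil_of_red _ hU] at h3
  rw [← h3, List.reverse_reverse]

lemma mem_run (S Y : List ℕ) (x : ℕ) (hx : x ∈ run S Y) : x ∈ S ∨ x ∈ Y := by
  induction Y generalizing S with
  | nil => simp at hx; exact Or.inl hx
  | cons y Y ih =>
    rw [run_cons] at hx
    rcases ih _ hx with h | h
    · cases S with
      | nil => simp [push] at h; simp [h]
      | cons s S =>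
        by_cases hs : s = y
        · simp [push, hs] at h; simp [h]
        · simp [push, hs] at h
          simp; tauto
    · simp [h]

lemma exists_factor (S : List ℕ) (h : Red S) (hn : ¬ S.Nodup) : ∃ (a : ℕ) (Z A B : List ℕ),
    Z ≠ [] ∧ Z.Nodup ∧ a ∉ Z ∧ S = A ++ a :: Z ++ a :: B := by
  induction S with
  | nil => simp at hn
  | cons s S ih =>
    by_cases hS : S.Nodup
    · have hs : s ∈ S := by
        by_contra hs
        exact hn (List.nodup_cons.2 ⟨hs, hS⟩)
      obtain ⟨Z, T, rfl⟩ := List.append_of_mem hs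
      refine ⟨s, Z, [], T, ?_, List.Nodup.of_append_left hS, ?_, by simp⟩
      · rintro rfl
        simp at h
      · intro hz
        exact (List.nodup_append.1 hS).2.2 s hz s (by simp) rfl
    · obtain ⟨a, Z, A, B, h1, h2, h3, rfl⟩ := ih h.tail hS
      exact ⟨a, Z, s :: A, B, h1, h2, h3, by simp⟩

namespace WC
variable {M : List ℕ → Prop}

lemma reduce (h : WC M) (Y : List ℕ) : ∀ (U S V : List ℕ), M (U ++ S.reverse ++ Y ++ V) →
    M (U ++ (run S Y).reverse ++ V) := by
  induction Y with
  | nil => intro U S V hw; simpa using hw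
  | cons y Y ih =>
    intro U S V hw
    rw [run_cons]
    apply ih
    cases S with
    | nil => simpa [push] using hw
    | cons s S =>
      by_cases hs : s = y
      · subst hs
        have := h.del s (U ++ S.reverse) (Y ++ V) (by simpa using hw)
        simpa [push] using this
      · simpa [push, hs] using hw

lemma piW_tail (h : WC M) (t : ℕ) (T : List ℕ) (hw : M (piW (t :: T))) : M (piW T) := by
  have h1 := h.del t T.reverse (T ++ T.reverse ++ t :: t :: T) (by simpa [piW] using hw)
  have h2 := h.del t (T.reverse ++ T ++ T.reverse) T (by simpa using h1)
  simpa [piW] using h2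

lemma piW_length (h : WC M) (T T' : List ℕ) (hT : T.Nodup) (hT' : T'.Nodup)
    (hl : T.length = T'.length) (hw : M (piW T)) : M (piW T') := by
  have h1 := h.relabel (piW T) (fun x => T'.getD (T.idxOf x) 0) (by
    intro x hx y hy hxy
    have hx : x ∈ T := by simpa [piW] using hx
    have hy : y ∈ T := by simpa [piW] using hy
    have hx' := List.idxOf_lt_length_iff.2 hx
    have hy' := List.idxOf_lt_length_iff.2 hy
    rw [List.getD_eq_getElem _ _ (by omega), List.getD_eq_getElem _ _ (by omega)] at hxy
    exact (List.idxOf_inj hx).1 ((List.Nodup.getElem_inj_iff hT').1 hxy)) hw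
  have h2 : T.map (fun x => T'.getD (T.idxOf x) 0) = T' := by
    apply List.ext_getElem (by simpa)
    intro i h1 h2
    simp at h1
    simp [hT.idxOf_getElem, h2]
  simpa only [piW, List.map_append, List.map_reverse, h2] using h1

lemma piW_le (h : WC M) (T T' : List ℕ) (hT : T.Nodup) (hT' : T'.Nodup)
    (hl : T'.length ≤ T.length) (hw : M (piW T)) : M (piW T') := by
  induction T with
  | nil => exact h.piW_length [] T' hT hT' (by simp at hl; simp [hl]) hw
  | cons t T ih =>
    by_cases he : T'.length = (t :: T).length
    · exact h.piW_length _ _ hT hT' he.symm hw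
    · exact ih (List.nodup_cons.1 hT).2 (by simp at hl he; omega) (h.piW_tail t T hw)

/-- A bound for the letters of a word. -/
lemma exists_bound (w : List ℕ) : ∃ N, 0 < N ∧ ∀ x ∈ w, x < N :=
  ⟨w.sum + 1, by omega, fun x hx => Nat.lt_succ_of_le (List.le_sum_of_mem hx)⟩

/-- The basic move: creating a pair on the other side of an excursion. -/
lemma move1 (h : WC M) (U S V : List ℕ) (y : ℕ)
    (hp : M (piW (List.range (S.length + 1)))) (hw : M (U ++ S ++ S.reverse ++ y :: V)) :
    M (U ++ y :: y :: S ++ S.reverse ++ y :: V) := by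
  obtain ⟨N, hN0, hN⟩ := exists_bound (U ++ S ++ S.reverse ++ y :: V)
  set S' := (List.range S.length).map (fun i => N + (i + 1)) with hS'
  have hnd : (N :: S').Nodup := by
    refine List.nodup_cons.2 ⟨by simp [hS'], ?_⟩
    exact List.Nodup.map (fun a b hab => by simpa using hab) List.nodup_range
  have hp' := h.piW_length _ (N :: S') List.nodup_range hnd (by simp [hS']) hp
  have hp2 : M (N :: S' ++ S'.reverse ++ [N, N] ++ S' ++ S'.reverse ++ [N]) := by
    have := h.comm (S'.reverse ++ [N]) (N :: S' ++ S'.reverse ++ [N, N] ++ S') (by simpa [piW] using hp')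
    simpa using this
  have hfresh : ∀ x ∈ N :: S' ++ S'.reverse ++ [N, N] ++ S' ++ S'.reverse ++ [N], N ≤ x := by
    intro x hx
    have hx2 : x = N ∨ x ∈ S' := by
      clear hp2 hp' hnd
      clear_value S'
      simp at hx
      tauto
    rcases hx2 with rfl | hx2
    · exact le_rfl
    · rw [hS'] at hx2
      obtain ⟨i, _, rfl⟩ := List.mem_map.1 hx2
      omega
  have h1 := h.ins (U ++ S ++ S.reverse ++ [y]) _ V (by
    intro x hx
    have hx := hfresh x hx
    constructor <;> intro hx'
    · have := hN x (by simp at hx' ⊢; tauto)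
      omega
    · have := hN x (by simp at hx' ⊢; tauto)
      omega) (by simpa using hw) hp2
  set f : ℕ → ℕ := fun x => if x < N then x else (y :: S).getD (x - N) 0 with hf
  have hfN : ∀ x, f x < N := by
    intro x
    simp only [hf]
    split_ifs with hx
    · exact hx
    · by_cases hl : x - N < (y :: S).length
      · rw [List.getD_eq_getElem _ _ hl]
        have h9 : (y :: S)[x - N] = y ∨ (y :: S)[x - N] ∈ S := List.mem_cons.1 (List.getElem_mem hl)
        apply hN
        simp only [List.mem_append, List.mem_cons]
        tauto
      · rw [List.getD_eq_default _ _ (by omega)]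
        exact hN0
  have hfid : ∀ x, x < N → f x = x := fun x hx => by simp [hf, hx]
  have hfNy : f N = y := by simp [hf]
  have hfS : S'.map f = S := by
    apply List.ext_getElem (by simp [hS'])
    intro i h1 h2
    simp [hS', hf, h2]
  have hmid : ∀ L : List ℕ, (∀ x ∈ L, x < N) → L.map f = L := by
    intro L hL
    conv_rhs => rw [← List.map_id L]
    exact List.map_congr_left (fun x hx => hfid x (hL x hx))
  have h2 := h.contrMany f (fun x => hfid _ (hfN x)) (N :: S' ++ S'.reverse) U
    ([N, N] ++ S' ++ S'.reverse ++ [N] ++ V) (by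
      intro x hx
      by_cases hxN : x < N
      · exact Or.inl (hfid x hxN)
      · right
        have hU := fun hh : x ∈ U => hxN (hN x (by simp [hh]))
        have hV := fun hh : x ∈ V => hxN (hN x (by simp [hh]))
        simp at hx ⊢
        tauto) (by
      have e : ((N :: S' ++ S'.reverse).map f).reverse = S ++ S.reverse ++ [y] := by
        simp [hfNy, hfS, ← List.map_reverse]
      rw [e]
      simpa using h1)
  have hU := hmid U (fun x hx => hN x (by simp [hx]))
  have hV := hmid V (fun x hx => hN x (by simp [hx]))
  simp only [List.map_append, List.map_reverse, hU, hV, hfS, List.map_cons, hfNy, List.map_nil] at h2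
  simpa using h2

/-- Moving a marker along a walk. -/
lemma move (h : WC M) (n : ℕ) (hp : ∀ l, l ≤ n → M (piW (List.range l))) (Y : List ℕ) :
    ∀ (U S V : List ℕ), (∀ A B, Y = A ++ B → (run S A).length ≤ n) →
    M (U ++ S ++ S.reverse ++ Y ++ V) → M (U ++ Y ++ run S Y ++ (run S Y).reverse ++ V) := by
  induction Y with
  | nil => intro U S V _ hw; simpa using hw
  | cons y Y ih =>
    intro U S V hb hw
    rw [run_cons]
    have hb' : ∀ A B, Y = A ++ B → (run (push y S) A).length ≤ n := by
      intro A B hAB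
      rw [← run_cons]
      exact hb (y :: A) B (by simp [hAB])
    have h1 : M ((U ++ [y]) ++ push y S ++ (push y S).reverse ++ Y ++ V) := by
      have hl := hb [y] Y rfl
      rw [run_cons, run_nil] at hl
      by_cases hs : ∃ S', S = y :: S'
      · obtain ⟨S', rfl⟩ := hs
        have := h.del y (U ++ y :: S' ++ S'.reverse) (Y ++ V) (by simpa using hw)
        simpa [push] using this
      · have e : push y S = y :: S := by
          cases S with
          | nil => rfl
          | cons s S =>
            have : s ≠ y := fun hh => hs ⟨S, by rw [hh]⟩
            simp [push, this]
        rw [e] at hl ⊢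
        have := h.move1 U S (Y ++ V) y (hp _ (by simpa using hl)) (by simpa using hw)
        simpa using this
    simpa using ih (U ++ [y]) (push y S) V hb' h1

end WC
end EasyQG

namespace EasyQG

/-- Words of a hyperoctahedral category which is not group-theoretical. -/
structure NG (M : List ℕ → Prop) : Prop extends WC M where
  four : M [0, 0, 0, 0]
  nds : ¬ M [0, 1]
  npp : ¬ M [0, 1, 0, 0, 1, 0]

namespace WC
variable {M : List ℕ → Prop}

lemma triple (h : WC M) (h4 : M [0, 0, 0, 0]) (u v : List ℕ) (a : ℕ) (hw : M (u ++ a :: v)) :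
    M (u ++ a :: a :: a :: v) := by
  have := h.move1 u [] v a (by simpa [piW, List.range_succ] using h4) (by simpa using hw)
  simpa using this

lemma mergeW (h : WC M) (h4 : M [0, 0, 0, 0]) (u v : List ℕ) (a b : ℕ) (hw : M (u ++ a :: b :: v)) :
    M ((u ++ a :: a :: v).map (fun x => if x = b then a else x)) := by
  have := h.contr a b (u ++ [a, a]) v (by simpa using h.triple h4 u (b :: v) a hw)
  simpa using this

lemma mirror (h : WC M) (A V : List ℕ) (N : ℕ) (hN : ∀ x ∈ A ++ V, x < N) (hw : M (A ++ V)) :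
    M (A ++ (A.map (fun x => if x ∈ V then x else x + N)).reverse) := by
  have h1 := h.rev _ (h.relabel _ (· + N) (fun x _ y _ hxy => by simpa using hxy) hw)
  have h2 := h.app _ _ (by
    intro x hx hx'
    have := hN x hx
    simp only [List.mem_reverse, List.mem_map] at hx'
    obtain ⟨y, _, rfl⟩ := hx'
    omega) hw h1
  set f : ℕ → ℕ := fun x => if N ≤ x ∧ x - N ∈ V then x - N else x with hf
  have hfid : ∀ x, x < N → f x = x := by
    intro x hx
    simp only [hf]
    rw [if_neg (by omega)]
  have hff : ∀ x, f (f x) = f x := by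
    intro x
    by_cases hx : N ≤ x ∧ x - N ∈ V
    · apply hfid
      simp only [hf]
      rw [if_pos hx]
      exact hN _ (by simp [hx.2])
    · have : f x = x := by
        simp only [hf]
        rw [if_neg hx]
      rw [this, this]
  have hfN : ∀ x, f (x + N) = if x ∈ V then x else x + N := by
    intro x
    simp [hf]
  have hmid : ∀ L : List ℕ, (∀ x ∈ L, x < N) → L.map f = L := by
    intro L hL
    conv_rhs => rw [← List.map_id L]
    exact List.map_congr_left (fun x hx => hfid x (hL x hx))
  have h3 := h.contrMany f hff (V.map (· + N)).reverse A (A.map (· + N)).reverse (by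
    intro x hx
    rcases List.mem_append.1 hx with hx | hx
    · exact Or.inl (hfid x (hN x (by simp [hx])))
    · simp only [List.mem_reverse, List.mem_map] at hx
      obtain ⟨y, hy, rfl⟩ := hx
      by_cases hyV : y ∈ V
      · right; simp [hyV]
      · left; rw [hfN, if_neg hyV]) (by
    have e : ((V.map (· + N)).reverse.map f).reverse = V := by
      rw [List.map_reverse, List.reverse_reverse, List.map_map]
      conv_rhs => rw [← List.map_id V]
      apply List.map_congr_left
      intro x hx
      simp [hfN, hx]
    rw [e]
    simpa using h2)
  rw [List.map_append, hmid A (fun x hx => hN x (by simp [hx])), List.map_reverse, List.map_map] at h3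
  convert h3 using 4
  funext x
  simp [hfN]

end WC

namespace NG
variable {M : List ℕ → Prop}

lemma not_single (h : NG M) (z : ℕ) (v : List ℕ) (hw : M (z :: v)) : z ∈ v := by
  by_contra hz
  obtain ⟨N, hN0, hN⟩ := WC.exists_bound ([z] ++ v)
  have h1 := h.mirror [z] v N hN hw
  simp only [List.map_cons, List.map_nil, hz, if_false, List.reverse_singleton] at h1
  have h2 := h.relabel _ (fun x => if x = z then 0 else 1) (by
    simp) h1
  exact h.nds (by simpa [show N ≠ 0 by omega] using h2)

lemma no_aba (h : NG M) (a b : ℕ) (V : List ℕ) (hab : a ≠ b) (hw : M (a :: b :: a :: V)) : False := by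
  have hb : b ∈ V := by
    have := h.not_single b (a :: V ++ [a]) (by simpa using h.comm [a] (b :: a :: V) hw)
    simp [Ne.symm hab] at this
    exact this
  obtain ⟨N, hN0, hN⟩ := WC.exists_bound ([a, b, a] ++ V)
  have haN := hN a (by simp)
  have hbN := hN b (by simp)
  have h1 := h.mirror [a, b, a] V N hN hw
  have h2 : M [a, b, a, a, b, a] := by
    by_cases ha : a ∈ V
    · simpa [ha, hb] using h1
    · simp [ha, hb] at h1
      have := h.mergeW h.four [a, b] [b, a + N] a (a + N) h1
      have e : b ≠ a + N := by omega
      simpa [e, show N ≠ 0 by omega] using this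
  have h3 := h.relabel _ (fun x => if x = a then 0 else 1) (by
    simp [Ne.symm hab]) h2
  exact h.npp (by simpa [Ne.symm hab] using h3)

lemma no_factor (h : NG M) (n : ℕ) : ∀ (a : ℕ) (Z V : List ℕ), Z.length = n → Z ≠ [] → Z.Nodup →
    a ∉ Z → M (a :: Z ++ a :: V) → False := by
  induction n using Nat.strong_induction_on with
  | _ n ih =>
    intro a Z V hn hZ hnd ha hw
    match Z, hn, hZ, hnd, ha, hw with
    | [b], _, _, _, ha, hw => exact h.no_aba a b V (by simpa using ha) (by simpa using hw)
    | [b, c], _, _, hnd, ha, hw =>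
      have h1 := h.mergeW h.four [] (c :: a :: V) a b (by simpa using hw)
      have hcb : c ≠ b := by simp at hnd; exact fun h => hnd h.symm
      simp at ha
      simp [hcb, ha.1] at h1
      set V' := V.map (fun x => if x = b then a else x)
      exact h.no_aba a c (V' ++ [a]) ha.2 (by simpa using h.comm [a] (a :: c :: a :: V') h1)
    | b :: c :: d :: Z', hn, _, hnd, ha, hw =>
      have h1 := h.contr b c [a] (d :: Z' ++ a :: V) (by simpa using hw)
      have hac : a ≠ c := by simp at ha; tauto
      have hid : (d :: Z').map (fun x => if x = c then b else x) = d :: Z' := by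
        conv_rhs => rw [← List.map_id (d :: Z')]
        apply List.map_congr_left
        intro x hx
        have : x ≠ c := by
          rintro rfl
          exact (List.nodup_cons.1 (List.nodup_cons.1 hnd).2).1 hx
        simp [this]
      rw [List.map_append, List.map_append, hid] at h1
      simp only [List.map_cons, List.map_nil, hac, if_false] at h1
      refine ih (d :: Z').length (by simp at hn ⊢; omega) a (d :: Z') _ rfl (by simp)
        (List.nodup_cons.1 (List.nodup_cons.1 hnd).2).2 (by simp at ha ⊢; tauto)
        (by simpa using h1)

lemma nodup (h : NG M) (U S V : List ℕ) (hS : Red S) (hw : M (U ++ S ++ V)) : S.Nodup := by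
  by_contra hn
  obtain ⟨a, Z, A, B, h1, h2, h3, rfl⟩ := exists_factor S hS hn
  refine h.no_factor _ a Z (B ++ V ++ (U ++ A)) rfl h1 h2 h3 ?_
  have := h.comm (U ++ A) (a :: Z ++ a :: B ++ V) (by simpa using hw)
  simpa using this

lemma run_eq_nil (h : NG M) (w : List ℕ) (hw : M w) : run [] w = [] := by
  have h1 := h.reduce w [] [] [] (by simpa using hw)
  have hr : Red (run [] w).reverse := red_reverse _ (run_red _ _ (by simp))
  have hnd := h.nodup [] _ [] hr h1
  simp at h1
  generalize (run [] w) = X at *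
  by_contra hX
  obtain ⟨z, v, hzv⟩ : ∃ z v, X.reverse = z :: v := by
    cases hx : X.reverse with
    | nil => simp at hx; exact absurd hx hX
    | cons z v => exact ⟨z, v, rfl⟩
  rw [hzv] at h1 hnd
  exact (List.nodup_cons.1 hnd).1 (h.not_single z v h1)

lemma run_between (h : NG M) (a : ℕ) (Y V : List ℕ) (ha : a ∉ Y) (hw : M (a :: Y ++ a :: V)) :
    run [] Y = [] := by
  have h1 := h.reduce Y [a] [] (a :: V) (by simpa using hw)
  have hr : Red (run [] Y).reverse := red_reverse _ (run_red _ _ (by simp))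
  have hnd := h.nodup [a] _ (a :: V) hr h1
  by_contra hne
  refine h.no_factor _ a (run [] Y).reverse V rfl (by simpa using hne) hnd ?_ (by simpa using h1)
  intro hm
  rcases mem_run [] Y a (by simpa using hm) with h2 | h2
  · simp at h2
  · exact ha h2

/-- A deep peak visited from two sides yields a partition `π`. -/
lemma exists_pi (h : NG M) (e z : ℕ) (A B R : List ℕ)
    (hw : M (e :: A ++ z :: z :: B ++ e :: e :: R))
    (hpush : run [e] (A ++ [z]) = z :: run [e] A)
    (hclosed : run [e] (A ++ z :: z :: B) = [e]) (hze : z ≠ e) (hzR : z ∈ R) :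
    (z :: run [e] A).Nodup ∧ M (piW (z :: run [e] A)) := by
  set S := run [e] A with hS
  have hTred : Red (z :: S) := by
    rw [← hpush]; exact run_red _ _ (by simp)
  have hSred : Red S := hTred.tail
  have hTred' := red_reverse _ hTred
  have hSred' := red_reverse _ hSred
  have hinv : run (z :: S) (z :: B ++ [e]) = [] := by
    rw [← hpush, ← run_append,
      show (A ++ [z]) ++ (z :: B ++ [e]) = (A ++ z :: z :: B) ++ [e] by simp, run_append, hclosed]
    simp [run]
  have h1 := h.reduce (A ++ [z]) [] [e] (z :: B ++ e :: e :: R) (by simpa using hw)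
  rw [hpush] at h1
  have h2 := h.reduce (z :: B ++ [e]) (z :: S).reverse [] (e :: R) (by simpa using h1)
  rw [run_inverse _ _ hTred hinv, List.reverse_reverse] at h2
  have hnd : (z :: S).Nodup := h.nodup (z :: S).reverse (z :: S) (e :: R) hTred (by simpa using h2)
  refine ⟨hnd, ?_⟩
  have hzS : z ∉ S := (List.nodup_cons.1 hnd).1
  obtain ⟨R1, R2, rfl, hzR1⟩ : ∃ R1 R2, R = R1 ++ z :: R2 ∧ z ∉ R1 := by
    obtain ⟨R1, R2, h1, h2⟩ := List.eq_append_cons_of_mem hzR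
    exact ⟨R1, R2, h1, h2⟩
  have h3 := h.run_between z (S ++ e :: R1) (R2 ++ (z :: S).reverse) (by
    simp [hzS, hze, hzR1]) (by
    have := h.comm (z :: S).reverse (z :: S ++ e :: R1 ++ z :: R2) (by simpa using h2)
    simpa using this)
  rw [run_append, run_nil_of_red S hSred] at h3
  have h4 := run_inverse _ _ hSred' h3
  rw [List.reverse_reverse] at h4
  have h5 := h.reduce (e :: R1) ((z :: S).reverse ++ (z :: S)) [] (z :: R2) (by simpa using h2)
  rw [h4] at h5
  have h6 : M ((z :: S).reverse ++ (z :: S) ++ (z :: S).reverse ++ R2) := by simpa using h5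
  have h7 := h.run_eq_nil _ h6
  rw [run_append, run_append, run_append, run_nil_of_red _ hTred', List.reverse_reverse] at h7
  have h8 : run (z :: S) (z :: S) = [] := by
    have := run_reverse [] (z :: S).reverse (by simp)
    rwa [run_nil_of_red _ hTred', List.reverse_reverse] at this
  rw [h8, run_nil_of_red _ hTred', List.reverse_reverse] at h7
  have h9 := run_inverse _ _ hTred h7
  have h10 := h.reduce R2 ((z :: S).reverse ++ (z :: S) ++ (z :: S).reverse) [] [] (by simpa using h6)
  rw [h9] at h10
  simpa [piW] using h10

end NG

lemma run_concat (S X : List ℕ) (x : ℕ) : run S (X ++ [x]) = push x (run S X) := by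
  rw [run_append, run_cons, run_nil]

lemma push_cases (y : ℕ) (S : List ℕ) : push y S = y :: S ∨ (push y S).length < S.length := by
  cases S with
  | nil => left; rfl
  | cons s S =>
    by_cases hs : s = y
    · right; simp [push, hs]
    · left; simp [push, hs]

/-- A nonempty closed walk has a peak of maximal height. -/
lemma exists_peak (e : ℕ) (Y : List ℕ) (hY : Y ≠ []) (he : e ∉ Y) (hc : run [e] Y = [e]) :
    ∃ (A : List ℕ) (z : ℕ) (B : List ℕ), Y = A ++ z :: z :: B ∧
      run [e] (A ++ [z]) = z :: run [e] A ∧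
      ∀ A' B', Y = A' ++ B' → (run [e] A').length ≤ (run [e] A).length + 1 := by
  obtain ⟨i, hi, hmax⟩ := Finset.exists_max_image (Finset.range (Y.length + 1))
    (fun i => (run [e] (Y.take i)).length) ⟨0, by simp⟩
  have hmax' : ∀ j, j ≤ Y.length → (run [e] (Y.take j)).length ≤ (run [e] (Y.take i)).length :=
    fun j hj => hmax j (by simpa using Nat.lt_succ_of_le hj)
  have hi : i ≤ Y.length := by simpa using Nat.le_of_lt_succ (by simpa using hi)
  have hlen : 0 < Y.length := List.length_pos_iff.2 hY
  have h2 : 2 ≤ (run [e] (Y.take i)).length := by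
    refine le_trans ?_ (hmax' 1 hlen)
    cases Y with
    | nil => simp at hY
    | cons y Y =>
      have : e ≠ y := by simp at he; tauto
      simp [run, this]
  have hi0 : i ≠ 0 := by
    rintro rfl
    simp at h2
  have hi1 : i ≠ Y.length := by
    rintro rfl
    simp [hc] at h2
  obtain ⟨j, rfl⟩ : ∃ j, i = j + 1 := ⟨i - 1, by omega⟩
  have hj1 : j + 1 < Y.length := by omega
  have ht1 : Y.take (j + 1) = Y.take j ++ [Y[j]] := by
    rw [List.take_append_getElem]
  have ht2 : Y.take (j + 1 + 1) = Y.take (j + 1) ++ [Y[j + 1]] := by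
    rw [List.take_append_getElem]
  have hm1 := hmax' j (by omega)
  have hm2 := hmax' (j + 1 + 1) (by omega)
  have hp : run [e] (Y.take j ++ [Y[j]]) = Y[j] :: run [e] (Y.take j) := by
    rw [ht1] at hm1
    rw [run_concat] at hm1 ⊢
    rcases push_cases Y[j] (run [e] (Y.take j)) with h | h
    · exact h
    · omega
  have hz : Y[j] = Y[j + 1] := by
    by_contra hne
    rw [ht2, run_concat, ht1, hp] at hm2
    simp [push, hne] at hm2
  refine ⟨Y.take j, Y[j], Y.drop (j + 1 + 1), ?_, hp, ?_⟩
  · conv_lhs => rw [← List.take_append_drop j Y, List.drop_eq_getElem_cons (by omega),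
      List.drop_eq_getElem_cons hj1, ← hz]
  · intro A' B' hAB
    have := hmax' A'.length (by rw [hAB]; simp)
    have e1 : Y.take A'.length = A' := by rw [hAB]; simp
    rw [e1, ht1, hp] at this
    simpa using this

/-- The induction step of the main argument. -/
lemma main_step {M D : List ℕ → Prop} (h : NG M) (hD : WC D)
    (hpi : ∀ l, M (piW (List.range l)) → D (piW (List.range l)))
    (N : ℕ) (IH : ∀ w : List ℕ, w.length < N → M w → D w) (n : ℕ) :
    ∀ (e : ℕ) (Y R : List ℕ), Y.length = n → e ∉ Y → (e :: Y ++ e :: e :: R).length = N →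
      M (e :: Y ++ e :: e :: R) → D (e :: Y ++ e :: e :: R) := by
  have hD4 : D [0, 0, 0, 0] := by
    have := hpi 1 (by simpa [piW, List.range_succ] using h.four)
    simpa [piW, List.range_succ] using this
  induction n using Nat.strong_induction_on with
  | _ n ih =>
    intro e Y R hn he hN hw
    have hdel : M (e :: Y ++ R) := h.del e (e :: Y) R hw
    have hDdel : D (e :: Y ++ R) := IH _ (by simp at hN ⊢; omega) hdel
    have hD3 : D (e :: e :: e :: Y ++ R) := hD.triple hD4 [] (Y ++ R) e hDdel
    by_cases hY : Y = []
    · subst hY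
      simpa using hD3
    have hcl0 := h.run_between e Y (e :: R) he hw
    have hcl : run [e] Y = [e] := by
      rw [← run_normal [e] Y (by simp), hcl0]; simp
    obtain ⟨A, z, B, rfl, hpush, hmax⟩ := exists_peak e Y hY he hcl
    have hze : z ≠ e := by
      rintro rfl
      simp at he
    by_cases hzR : z ∈ R
    · obtain ⟨hnd, hpiM⟩ := h.exists_pi e z A B R hw hpush hcl hze hzR
      have hpD : ∀ l, l ≤ (run [e] A).length + 1 → D (piW (List.range l)) := by
        intro l hl
        exact hpi l (h.piW_le _ _ hnd List.nodup_range (by simpa using hl) hpiM)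
      have := hD.move _ hpD (A ++ z :: z :: B) [e] [e] R hmax (by simpa using hD3)
      rw [hcl] at this
      simpa using this
    · by_cases hzA : z ∈ A
      · obtain ⟨Y', A', hA, hzY'⟩ := List.eq_append_cons_of_mem (List.mem_reverse.2 hzA)
        have hA' : A = A'.reverse ++ z :: Y'.reverse := by
          rw [← List.reverse_reverse A, hA]; simp
        subst hA'
        have h1 := h.comm (e :: A'.reverse) (z :: Y'.reverse ++ z :: z :: B ++ e :: e :: R)
          (by simpa using hw)
        have h2 := ih Y'.length (by simp at hn; omega) z Y'.reverse
          (B ++ e :: e :: R ++ e :: A'.reverse) (by simp) (by simpa using hzY')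
          (by simp at hN ⊢; omega) (by simpa using h1)
        have h3 := hD.comm (z :: Y'.reverse ++ z :: z :: B ++ e :: e :: R) (e :: A'.reverse)
          (by simpa using h2)
        simpa using h3
      by_cases hzB : z ∈ B
      · obtain ⟨Y', B', rfl, hzY'⟩ := List.eq_append_cons_of_mem hzB
        have h0 := h.comm (e :: A ++ z :: z :: Y' ++ [z]) (B' ++ e :: e :: R)
          (by simpa using hw)
        have h1 := h.rev _ h0
        have h2 := ih Y'.length (by simp at hn; omega) z Y'.reverse
          ((e :: A).reverse ++ (B' ++ e :: e :: R).reverse) (by simp) (by simpa using hzY')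
          (by simp at hN ⊢; omega) (by simpa using h1)
        have h3 := hD.rev _ h2
        have h4 := hD.comm (B' ++ e :: e :: R) (e :: A ++ z :: z :: Y' ++ [z])
          (by simpa using h3)
        simpa using h4
      · have h1 := h.del z (e :: A) (B ++ e :: e :: R) (by simpa using hw)
        have h2 := IH _ (by simp at hN ⊢; omega) h1
        have h3 := hD.ins (e :: A) [z, z] (B ++ e :: e :: R) (by
          intro y hy
          have : y = z := by simpa using hy
          subst this
          simp [hze, hzA, hzB, hzR]) h2 (by
            simpa using hD.relabel _ (fun _ => z) (by simp) hD.pair)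
        simpa using h3

lemma not_red_factor (w : List ℕ) (h : ¬ Red w) : ∃ (a : ℕ) (u v : List ℕ), w = u ++ a :: a :: v := by
  induction w with
  | nil => simp at h
  | cons x w ih =>
    by_cases hw : Red w
    · cases w with
      | nil => simp at h
      | cons y w =>
        have : x = y := by
          by_contra hxy
          exact h (List.isChain_cons_cons.2 ⟨hxy, hw⟩)
        subst this
        exact ⟨x, [], w, rfl⟩
    · obtain ⟨a, u, v, rfl⟩ := ih hw
      exact ⟨a, x :: u, v, rfl⟩

theorem main_words {M D : List ℕ → Prop} (h : NG M) (hD : WC D)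
    (hpi : ∀ l, M (piW (List.range l)) → D (piW (List.range l))) :
    ∀ (N : ℕ) (w : List ℕ), w.length = N → M w → D w := by
  intro N
  induction N using Nat.strong_induction_on with
  | _ N IH =>
    intro w hN hw
    by_cases hw0 : w = []
    · subst hw0; exact hD.nil
    have hred : ¬ Red w := by
      intro hr
      have h1 := h.run_eq_nil w hw
      rw [run_nil_of_red w hr] at h1
      simp at h1
      exact hw0 h1
    obtain ⟨a, u, v, rfl⟩ := not_red_factor w hred
    have h1 : M (v ++ u ++ [a, a]) := by
      simpa using h.comm (u ++ [a, a]) v (by simpa using hw)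
    suffices h2 : D (v ++ u ++ [a, a]) by
      simpa using hD.comm v (u ++ [a, a]) (by simpa using h2)
    have hl : (v ++ u).length + 2 = N := by simp at hN ⊢; omega
    generalize v ++ u = V at *
    by_cases ha : a ∈ V
    · obtain ⟨Y', A', hA, haY'⟩ := List.eq_append_cons_of_mem (List.mem_reverse.2 ha)
      have hV : V = A'.reverse ++ a :: Y'.reverse := by
        rw [← List.reverse_reverse V, hA]; simp
      subst hV
      have h3 := h.comm A'.reverse (a :: Y'.reverse ++ [a, a]) (by simpa using h1)
      have h4 := main_step h hD hpi N (fun w hw => IH _ hw w rfl) _ a Y'.reverse A'.reverse rfl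
        (by simpa using haY') (by simp at hl ⊢; omega) (by simpa using h3)
      have h5 := hD.comm (a :: Y'.reverse ++ [a, a]) A'.reverse (by simpa using h4)
      simpa using h5
    · have h2 := IH V.length (by omega) V rfl (by simpa using h.del a V [] h1)
      exact hD.app V [a, a] (by
        intro x hx hx'
        have : x = a := by simpa using hx'
        exact ha (this ▸ hx)) h2 (by simpa using hD.relabel _ (fun _ => a) (by simp) hD.pair)

end EasyQG


namespace EasyQG

lemma WC_of (C : PartitionCategory) : WC (VMem C []) where
  pair := VMem_pair C
  relabel := fun w f hf hw => VMem_relabel C w f hf hw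
  comm := fun u v h => VMem_comm C u v h
  rev := fun w h => VMem_rev C w h
  app := fun w v hd hw hv => VMem_app C w v hd hw hv
  contr0 := fun a b v h => VMem_contr C a b v h

lemma mem_fourBlock (C : PartitionCategory) :
    (⟨0, 4, fourBlock⟩ : Σ k l : ℕ, Partition k l) ∈ C.mem ↔ VMem C [] [0, 0, 0, 0] := by
  refine mem_VMem C fourBlock [] [0, 0, 0, 0] rfl rfl ?_
  rintro (x | x) (y | y)
  · exact x.elim0
  · exact x.elim0
  · exact y.elim0
  · refine ⟨fun _ => ?_, fun _ => trivial⟩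
    fin_cases x <;> fin_cases y <;> rfl

lemma mem_doubleSingleton (C : PartitionCategory) :
    (⟨0, 2, doubleSingleton⟩ : Σ k l : ℕ, Partition k l) ∈ C.mem ↔ VMem C [] [0, 1] := by
  refine mem_VMem C doubleSingleton [] [0, 1] rfl rfl ?_
  rintro (x | x) (y | y)
  · exact x.elim0
  · exact x.elim0
  · exact y.elim0
  · change (Sum.inr x : Fin 0 ⊕ Fin 2) = Sum.inr y ↔ _
    fin_cases x <;> fin_cases y <;> simp

lemma mem_pairPositioner (C : PartitionCategory) :
    (⟨3, 3, pairPositioner⟩ : Σ k l : ℕ, Partition k l) ∈ C.mem ↔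
      VMem C [0, 0, 1] [1, 0, 0] := by
  refine mem_VMem C pairPositioner [0, 0, 1] [1, 0, 0] rfl rfl ?_
  intro x y
  change Sum.elim (fun i : Fin 3 => decide (i.val < 2)) (fun j : Fin 3 => decide (1 ≤ j.val)) x =
    Sum.elim (fun i : Fin 3 => decide (i.val < 2)) (fun j : Fin 3 => decide (1 ≤ j.val)) y ↔ _
  revert x y
  decide

lemma NG_of (C : PartitionCategory) (hH : Hyperoctahedral C) (hG : ¬ GroupTheoretical C) :
    NG (VMem C []) :=
  { WC_of C with
    four := (mem_fourBlock C).1 hH.1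
    nds := fun h => hH.2 ((mem_doubleSingleton C).2 h)
    npp := fun h => hG ((mem_pairPositioner C).2 ((VMem_iff C _ _).2
      (VMem_comm C [0] [1, 0, 0, 1, 0] h))) }

lemma pi_word_get (l i : ℕ) (hi : i < (piW (List.range l).reverse).length) :
    (piW (List.range l).reverse)[i] =
      if i % (2 * l) < l then i % (2 * l) else 2 * l - 1 - i % (2 * l) := by
  have hi' : i < 4 * l := by
    simp [piW] at hi; omega
  have hm : i % (2 * l) = if i < 2 * l then i else i - 2 * l := by
    split_ifs with h
    · exact Nat.mod_eq_of_lt h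
    · rw [Nat.mod_eq_sub_mod (by omega), Nat.mod_eq_of_lt (by omega)]
  rw [hm]
  simp only [piW, List.reverse_reverse]
  simp only [List.getElem_append, List.getElem_range, List.getElem_reverse, List.length_append,
    List.length_range, List.length_reverse]
  split_ifs <;> omega

lemma mem_pi (C : PartitionCategory) (l : ℕ) :
    (⟨0, 4 * l, piPartition l⟩ : Σ k l : ℕ, Partition k l) ∈ C.mem ↔
      VMem C [] (piW (List.range l)) := by
  have hlen : (piW (List.range l).reverse).length = 4 * l := by simp [piW]; omega
  have h1 : (⟨0, 4 * l, piPartition l⟩ : Σ k l : ℕ, Partition k l) ∈ C.mem ↔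
      VMem C [] (piW (List.range l).reverse) := by
    refine mem_VMem C (piPartition l) [] _ rfl hlen ?_
    rintro (x | x) (y | y)
    · exact x.elim0
    · exact x.elim0
    · exact y.elim0
    · simp only [Sum.elim_inr, List.get_eq_getElem, Fin.val_cast, pi_word_get]
      exact Iff.rfl
  have hn : (List.range l).Nodup := List.nodup_range
  have hn' : (List.range l).reverse.Nodup := List.nodup_reverse.2 hn
  rw [h1]
  exact ⟨fun h => (WC_of C).piW_length _ _ hn' hn (by simp) h,
    fun h => (WC_of C).piW_length _ _ hn hn' (by simp) h⟩

/-- Comparison of a non group-theoretical hyperoctahedral category with another category. -/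
lemma mem_of_pi (C D : PartitionCategory) (hH : Hyperoctahedral C) (hG : ¬ GroupTheoretical C)
    (hpi : ∀ l, VMem C [] (piW (List.range l)) → VMem D [] (piW (List.range l))) :
    C.mem ⊆ D.mem := by
  rintro ⟨k, l, p⟩ hp
  obtain ⟨u, v, huv⟩ := exists_lists p
  rw [huv] at hp ⊢
  rw [VMem_iff] at hp ⊢
  exact main_words (NG_of C hH hG) (WC_of D) hpi _ _ rfl hp

theorem statement0 (C : PartitionCategory) (hH : Hyperoctahedral C)
    (hG : ¬ GroupTheoretical C) :
    (∃ k : ℕ, 1 ≤ k ∧ C.mem = generated (piUpTo k)) ∨ C.mem = generated piAll := by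
  have hdown : ∀ a b, a ≤ b → VMem C [] (piW (List.range b)) → VMem C [] (piW (List.range a)) :=
    fun a b hab h => (WC_of C).piW_le _ _ List.nodup_range List.nodup_range (by simpa using hab) h
  have hone : VMem C [] (piW (List.range 1)) := (mem_fourBlock C).1 hH.1
  by_cases hall : ∀ l, VMem C [] (piW (List.range l))
  · right
    apply Set.Subset.antisymm
    · intro x hx D hD
      refine mem_of_pi C D hH hG (fun l _ => ?_) hx
      rcases Nat.eq_zero_or_pos l with rfl | hl
      · exact (WC_of D).nil
      · exact (mem_pi D l).1 (hD ⟨l, hl, rfl⟩)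
    · intro x hx
      refine hx C ?_
      rintro _ ⟨l, _, rfl⟩
      exact (mem_pi C l).2 (hall l)
  · left
    push Not at hall
    classical
    have hspec := Nat.find_spec hall
    have hmin := fun m => Nat.find_min hall (m := m)
    set n := Nat.find hall with hn
    have hn2 : 2 ≤ n := by
      by_contra hlt
      exact hspec (hdown n 1 (by omega) hone)
    refine ⟨n - 1, by omega, ?_⟩
    apply Set.Subset.antisymm
    · intro x hx D hD
      refine mem_of_pi C D hH hG (fun l hl => ?_) hx
      rcases Nat.eq_zero_or_pos l with rfl | hl0
      · exact (WC_of D).nil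
      · refine (mem_pi D l).1 (hD ⟨l, hl0, ?_, rfl⟩)
        by_contra hlt
        exact hspec (hdown n l (by omega) hl)
    · intro x hx
      refine hx C ?_
      rintro _ ⟨l, _, hl, rfl⟩
      exact (mem_pi C l).2 (not_not.1 (hmin l (by omega)))

end EasyQG
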